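/- Let (G, v₀) be a multiplayer quantitative reachability game, Γ = 2·|Π|·|V|, and d = Γ + 3·|V|. If there exists a secure equilibrium in (G, v₀), then there exists a goal-optimal and dev-optimal secure equilibrium in the truncated game 𝒯^d. -/

import Mathlib

open scoped Classical ENat

/-- A multiplayer quantitative reachability game: a finite directed graph whose
vertices are partitioned among the players (via `owner`), every vertex has an
outgoing edge, and each player `i` has a nonempty goal set `F i`. -/
structure QRGame (ι V : Type) where
  owner : V → ι
  E : V → V → Prop
  total : ∀ v, ∃ w, E v w
  F : ι → Set V
  F_ne : ∀ i, (F i).Nonempty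

namespace QRGame

variable {ι V : Type}

/-- Histories are encoded as *reversed* nonempty lists: the head is the current
vertex, the last element is the initial vertex `v₀`, and consecutive elements
are joined by edges of the graph. -/
def IsHist (G : QRGame ι V) (v₀ : V) : List V → Prop
  | [] => False
  | [v] => v = v₀
  | v :: w :: t => G.E w v ∧ IsHist G v₀ (w :: t)

/-- The current (i.e. most recent) vertex of a history. -/
def cur (v₀ : V) (h : List V) : V := h.headD v₀

/-- `σ` is a valid strategy of player `i`: on every history whose current
vertex belongs to player `i`, it chooses a successor along an edge. -/
def IsStrat (G : QRGame ι V) (v₀ : V) (i : ι) (σ : List V → V) : Prop :=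
  ∀ h : List V, G.IsHist v₀ h → G.owner (cur v₀ h) = i → G.E (cur v₀ h) (σ h)

/-- A strategy profile: one valid strategy for each player. -/
def IsProfile (G : QRGame ι V) (v₀ : V) (σ : ι → List V → V) : Prop :=
  ∀ i, G.IsStrat v₀ i (σ i)

/-- The history reached after `n` further steps when all players follow the
profile `σ` from the history `h` on. -/
def histFrom (G : QRGame ι V) (v₀ : V) (σ : ι → List V → V) (h : List V) : ℕ → List V
  | 0 => h
  | n + 1 =>
      σ (G.owner (cur v₀ (histFrom G v₀ σ h n))) (histFrom G v₀ σ h n)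
        :: histFrom G v₀ σ h n

/-- The full play (indexed from time `0`) whose prefix is the history `h` and
which is consistent with the profile `σ` after `h`. -/
def fullPlay (G : QRGame ι V) (v₀ : V) (σ : ι → List V → V) (h : List V) (t : ℕ) : V :=
  (G.histFrom v₀ σ h t).reverse.getD t v₀

/-- The outcome `⟨(σ_i)⟩_{v₀}` of the profile `σ` from the initial vertex. -/
def outcome (G : QRGame ι V) (v₀ : V) (σ : ι → List V → V) : ℕ → V :=
  G.fullPlay v₀ σ [v₀]

/-- Cost of player `i` for a play `ρ`: the least `l` with `ρ l ∈ F i`,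
and `⊤` (i.e. `+∞`) if there is no such `l`. -/
noncomputable def cost (G : QRGame ι V) (i : ι) (ρ : ℕ → V) : ℕ∞ :=
  ⨅ l ∈ {l : ℕ | ρ l ∈ G.F i}, (l : ℕ∞)

/-- Cost of player `i` for the finite prefix `ρ₀ … ρ_{m-1}` of a play. -/
noncomputable def costLT (G : QRGame ι V) (i : ι) (ρ : ℕ → V) (m : ℕ) : ℕ∞ :=
  ⨅ l ∈ {l : ℕ | l < m ∧ ρ l ∈ G.F i}, (l : ℕ∞)

end QRGame

/-- The preference relation `≺_j` of player `j` on cost profiles: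
`x ≺_j y` iff `x j > y j`, or `x j = y j`, every player's cost does not
decrease, and some player's cost strictly increases. -/
def Prec {ι : Type} (j : ι) (x y : ι → ℕ∞) : Prop :=
  y j < x j ∨ (x j = y j ∧ (∀ i, x i ≤ y i) ∧ ∃ i, x i < y i)

namespace QRGame

variable {ι V : Type} [DecidableEq ι]

/-- `σ` restricted after the history `h` is a secure equilibrium in the subgame
`(G|_h, cur h)`: no player `j` has a `≺_j`-profitable deviation after `h`
(costs are computed on the whole play, including the prefix `h`). -/
def IsSecureAfter (G : QRGame ι V) (v₀ : V) (σ : ι → List V → V) (h : List V) : Prop :=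
  ¬ ∃ (j : ι) (σ' : List V → V), G.IsStrat v₀ j σ' ∧
      Prec j (fun i => G.cost i (G.fullPlay v₀ σ h))
        (fun i => G.cost i (G.fullPlay v₀ (Function.update σ j σ') h))

/-- A secure equilibrium in `(G, v₀)`. -/
def IsSecure (G : QRGame ι V) (v₀ : V) (σ : ι → List V → V) : Prop :=
  G.IsSecureAfter v₀ σ [v₀]

/-- A subgame perfect secure equilibrium: a secure equilibrium in every subgame. -/
def IsSPSE (G : QRGame ι V) (v₀ : V) (σ : ι → List V → V) : Prop :=
  ∀ h : List V, G.IsHist v₀ h → G.IsSecureAfter v₀ σ h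

end QRGame

namespace QRGame

variable {ι V : Type}

/-- `σ` is a valid strategy of player `i` in the truncated game `𝒯^d` played on
the truncation of the unraveling of `G` to depth `d`: it chooses a successor
along an edge on every history of length (number of edges) `< d`, i.e. on every
history whose list of vertices has length `≤ d`. -/
def IsStratTrunc (G : QRGame ι V) (v₀ : V) (d : ℕ) (i : ι) (σ : List V → V) : Prop :=
  ∀ h : List V, G.IsHist v₀ h → h.length ≤ d →
    G.owner (cur v₀ h) = i → G.E (cur v₀ h) (σ h)

end QRGame

namespace QRGame

variable {ι V : Type} [DecidableEq ι]

/-- `σ` restricted after the history `h` is a secure equilibrium in the subgame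
of the truncated game `𝒯^d` after `h`: costs are computed on the prefix of the
play of length `d` (vertices of indices `0, …, d`). -/
def IsSecureTruncAfter (G : QRGame ι V) (v₀ : V) (d : ℕ)
    (σ : ι → List V → V) (h : List V) : Prop :=
  ¬ ∃ (j : ι) (σ' : List V → V), G.IsStratTrunc v₀ d j σ' ∧
      Prec j (fun i => G.costLT i (G.fullPlay v₀ σ h) (d + 1))
        (fun i => G.costLT i (G.fullPlay v₀ (Function.update σ j σ') h) (d + 1))

/-- A secure equilibrium in the truncated game `𝒯^d`. -/
def IsSecureTrunc (G : QRGame ι V) (v₀ : V) (d : ℕ) (σ : ι → List V → V) : Prop :=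
  G.IsSecureTruncAfter v₀ d σ [v₀]

/-- A subgame perfect secure equilibrium in the truncated game `𝒯^d`: a secure
equilibrium in the subgame after every history of the truncated tree. -/
def IsSPSETrunc (G : QRGame ι V) (v₀ : V) (d : ℕ) (σ : ι → List V → V) : Prop :=
  ∀ h : List V, G.IsHist v₀ h → h.length ≤ d + 1 → G.IsSecureTruncAfter v₀ d σ h

end QRGame

namespace QRGame

variable {ι V : Type} [Fintype V]

/-- Goal-optimality (with bound `Γ`) in the truncated game `𝒯^d`: costs are
computed on the outcome of the truncated game, i.e. on the prefix of length `d`. -/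
noncomputable def GoalOptTrunc (G : QRGame ι V) (v₀ : V) (d : ℕ)
    (σ : ι → List V → V) (Γ : ℕ) : Prop :=
  ∀ i, G.costLT i (G.outcome v₀ σ) (d + 1) ≠ ⊤ →
    G.costLT i (G.outcome v₀ σ) (d + 1) < (Γ : ℕ∞)

/-- The bound `D = max{Cost_i(ρ) : Cost_i(ρ) < +∞} + |V|` attached to the
outcome of a profile in the truncated game `𝒯^d`. -/
noncomputable def devBoundTrunc (G : QRGame ι V) (v₀ : V) (d : ℕ)
    (σ : ι → List V → V) : ℕ :=
  (⨆ i ∈ {i : ι | G.costLT i (G.outcome v₀ σ) (d + 1) ≠ ⊤},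
      G.costLT i (G.outcome v₀ σ) (d + 1)).toNat + Fintype.card V

variable [DecidableEq ι]

/-- Dev-optimality of a secure equilibrium in the truncated game `𝒯^d`. -/
noncomputable def DevOptTrunc (G : QRGame ι V) (v₀ : V) (d : ℕ)
    (σ : ι → List V → V) : Prop :=
  ∀ (j : ι) (σ' : List V → V), G.IsStratTrunc v₀ d j σ' →
    ¬ Prec j
        (fun i => G.costLT i (G.outcome v₀ σ) (G.devBoundTrunc v₀ d σ))
        (fun i => G.costLT i (G.outcome v₀ (Function.update σ j σ'))
          (G.devBoundTrunc v₀ d σ))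

end QRGame

namespace QRGame

variable {ι V : Type} {G : QRGame ι V} {v₀ : V}

/-- The cost of player `i` when only the vertices of index less than `N` count. -/
noncomputable def horizonCost (G : QRGame ι V) (N : ℕ∞) (i : ι) (π : ℕ → V) : ℕ∞ :=
  ⨅ l ∈ {l : ℕ | (l : ℕ∞) < N ∧ π l ∈ G.F i}, (l : ℕ∞)

lemma horizonCost_top (i : ι) (π : ℕ → V) : G.horizonCost ⊤ i π = G.cost i π := by
  simp [horizonCost, cost]

lemma horizonCost_coe (m : ℕ) (i : ι) (π : ℕ → V) :
    G.horizonCost m i π = G.costLT i π m := by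
  simp [horizonCost, costLT]

lemma le_horizonCost_iff {N a : ℕ∞} {i : ι} {π : ℕ → V} :
    a ≤ G.horizonCost N i π ↔ ∀ l : ℕ, (l : ℕ∞) < N → π l ∈ G.F i → a ≤ l := by
  simp [horizonCost, le_iInf_iff]

lemma horizonCost_le {N : ℕ∞} {i : ι} {π : ℕ → V} {l : ℕ} (hN : (l : ℕ∞) < N)
    (hl : π l ∈ G.F i) : G.horizonCost N i π ≤ l :=
  le_horizonCost_iff.1 le_rfl l hN hl

lemma horizonCost_lt_iff {N a : ℕ∞} {i : ι} {π : ℕ → V} :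
    G.horizonCost N i π < a ↔ ∃ l : ℕ, (l : ℕ∞) < N ∧ π l ∈ G.F i ∧ (l : ℕ∞) < a := by
  rw [← not_le, le_horizonCost_iff]
  push Not
  rfl

lemma exists_eq_horizonCost {N : ℕ∞} {i : ι} {π : ℕ → V} (h : G.horizonCost N i π ≠ ⊤) :
    ∃ l : ℕ, (l : ℕ∞) < N ∧ π l ∈ G.F i ∧ G.horizonCost N i π = l := by
  obtain ⟨m, hm⟩ := ENat.ne_top_iff_exists.1 h
  obtain ⟨l, hN, hl, hlt⟩ := horizonCost_lt_iff.1
    (show G.horizonCost N i π < (m + 1 : ℕ) by rw [← hm]; exact_mod_cast Nat.lt_succ_self m)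
  refine ⟨l, hN, hl, le_antisymm (horizonCost_le hN hl) ?_⟩
  rw [← hm]
  exact_mod_cast Nat.lt_succ_iff.1 (by exact_mod_cast hlt)

/-- A goal visited while two plays still coincide has the same cost in both. -/
lemma horizonCost_eq_of_agree {M N : ℕ∞} {i : ι} {π ρ : ℕ → V} {p : ℕ}
    (hag : ∀ u ≤ p, π u = ρ u) (hM : (p : ℕ∞) < M) (hN : (p : ℕ∞) < N)
    (h : G.horizonCost M i ρ ≤ p) : G.horizonCost N i π = G.horizonCost M i ρ := by
  obtain ⟨m, -, hm, hmeq⟩ := exists_eq_horizonCost (ne_top_of_le_ne_top (ENat.natCast_ne_top p) h)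
  have hmp : m ≤ p := by rw [hmeq] at h; exact_mod_cast h
  have hmN : (m : ℕ∞) < N := lt_of_le_of_lt (by exact_mod_cast hmp) hN
  refine le_antisymm ?_ (le_horizonCost_iff.2 fun l _ hl => ?_)
  · rw [hmeq]
    exact horizonCost_le hmN (by rwa [hag m hmp])
  · by_cases hlp : l ≤ p
    · exact horizonCost_le (lt_of_le_of_lt (by exact_mod_cast hlp) hM) (by rwa [← hag l hlp])
    · exact h.trans (by exact_mod_cast (not_le.1 hlp).le)

/-- If `α` reads as `β` delayed by `δ` from time `p` on, and neither visits the goal of `i`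
before, then the costs differ by `δ`. -/
lemma horizonCost_top_eq_add {i : ι} {α β : ℕ → V} {p δ : ℕ}
    (hα : ∀ l, α l ∈ G.F i → p + δ ≤ l) (hβ : ∀ l, β l ∈ G.F i → p ≤ l)
    (h : ∀ t, p ≤ t → α (t + δ) = β t) :
    G.horizonCost ⊤ i α = G.horizonCost ⊤ i β + δ := by
  refine le_antisymm ?_ (le_horizonCost_iff.2 fun l _ hl => ?_)
  · by_cases htop : G.horizonCost ⊤ i β = ⊤
    · simp [htop]
    · obtain ⟨l, -, hl, hleq⟩ := exists_eq_horizonCost htop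
      rw [hleq]
      have hlα : α (l + δ) ∈ G.F i := by rwa [h l (hβ l hl)]
      have hle := horizonCost_le (N := ⊤) (ENat.natCast_lt_top _) hlα
      rwa [Nat.cast_add] at hle
  · obtain ⟨t, rfl⟩ := Nat.exists_eq_add_of_le (hα l hl)
    have ht : β (p + t) ∈ G.F i := by
      rw [← h _ (by omega)]
      convert hl using 2
      omega
    have hle := add_le_add_left (horizonCost_le (N := ⊤) (ENat.natCast_lt_top _) ht) (δ : ℕ∞)
    rwa [← Nat.cast_add, Nat.add_right_comm] at hle

lemma lt_add_natCast {a : ℕ∞} (ha : a ≠ ⊤) {n : ℕ} (hn : 0 < n) : a < a + n := by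
  obtain ⟨m, rfl⟩ := ENat.ne_top_iff_exists.1 ha
  exact_mod_cast Nat.lt_add_of_pos_right hn

lemma horizonCost_congr {N : ℕ∞} (i : ι) {π π' : ℕ → V}
    (h : ∀ l : ℕ, (l : ℕ∞) < N → π l = π' l) :
    G.horizonCost N i π = G.horizonCost N i π' := by
  apply le_antisymm <;> rw [le_horizonCost_iff] <;> intro l hN hl
  · exact horizonCost_le hN (by rwa [h l hN])
  · exact horizonCost_le hN (by rwa [← h l hN])

lemma horizonCost_anti {M N : ℕ∞} (h : M ≤ N) (i : ι) (π : ℕ → V) :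
    G.horizonCost N i π ≤ G.horizonCost M i π :=
  le_horizonCost_iff.2 fun _ hM hl => horizonCost_le (hM.trans_le h) hl

lemma horizonCost_eq_of_lt {M N : ℕ∞} {i : ι} {π : ℕ → V} (h : M ≤ N)
    (hlt : G.horizonCost N i π < M) : G.horizonCost M i π = G.horizonCost N i π := by
  refine le_antisymm (le_horizonCost_iff.2 fun l hN hl => ?_) (horizonCost_anti h i π)
  by_cases hM : (l : ℕ∞) < M
  · exact horizonCost_le hM hl
  · obtain ⟨l', _, hl', hM'⟩ := horizonCost_lt_iff.1 hlt
    exact (horizonCost_le hM' hl').trans (hM'.le.trans (not_lt.1 hM))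

lemma not_prec_self (j : ι) (x : ι → ℕ∞) : ¬ Prec j x x := by
  rintro (h | ⟨_, _, i, h⟩) <;> exact lt_irrefl _ h

/-- Infinite paths of the graph starting in `v₀`. -/
def IsPlay (G : QRGame ι V) (v₀ : V) (π : ℕ → V) : Prop :=
  π 0 = v₀ ∧ ∀ t, G.E (π t) (π (t + 1))

/-- A response rule selects a successor of `π t` from the prefix of `π` up to time `t`. -/
structure IsResponse (G : QRGame ι V) (S : (ℕ → V) → ℕ → V) : Prop where
  congr : ∀ {π π' : ℕ → V} {t : ℕ}, (∀ u ≤ t, π u = π' u) → S π t = S π' t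
  edge : ∀ π t, G.E (π t) (S π t)

/-- From time `k` on, all vertices not owned by `j` are left according to `S`. -/
def Follows (G : QRGame ι V) (j : ι) (S : (ℕ → V) → ℕ → V) (k : ℕ) (π : ℕ → V) : Prop :=
  ∀ t, k ≤ t → G.owner (π t) ≠ j → π (t + 1) = S π t

/-- The play `π` leaves `ρ` right after time `k`, at a vertex of player `j`, and the other
players answer with `S` from then on. -/
structure IsDeviation (G : QRGame ι V) (v₀ : V) (ρ : ℕ → V) (j : ι) (S : (ℕ → V) → ℕ → V)
    (k : ℕ) (π : ℕ → V) : Prop where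
  play : G.IsPlay v₀ π
  agree : ∀ u ≤ k, π u = ρ u
  owner : G.owner (ρ k) = j
  ne : π (k + 1) ≠ ρ (k + 1)
  follows : G.Follows j S (k + 1) π

/-- The responses `S j` make all deviations of player `j` from `ρ` unprofitable, costs being
computed up to the horizon `N`. -/
def Deters (G : QRGame ι V) (v₀ : V) (N : ℕ∞) (ρ : ℕ → V) (S : ι → (ℕ → V) → ℕ → V) : Prop :=
  ∀ j k π, G.IsDeviation v₀ ρ j (S j) k π →
    ¬ Prec j (fun i => G.horizonCost N i ρ) (fun i => G.horizonCost N i π)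

lemma exists_extension {f : (ℕ → V) → ℕ → V}
    (hf : ∀ {π π' : ℕ → V} {t : ℕ}, (∀ u ≤ t, π u = π' u) → f π t = f π' t)
    (π : ℕ → V) (p : ℕ) :
    ∃ π' : ℕ → V, (∀ u ≤ p, π' u = π u) ∧ ∀ t, p ≤ t → π' (t + 1) = f π' t := by
  let g : ℕ → ℕ → V := fun n => Nat.rec π
    (fun n gn => Function.update gn (p + n + 1) (f gn (p + n))) n
  have hg : ∀ n, g (n + 1) = Function.update (g n) (p + n + 1) (f (g n) (p + n)) :=
    fun n => rfl
  have hstab : ∀ n m u, u ≤ p + n → g (n + m) u = g n u := by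
    intro n m u hu
    induction m with
    | zero => rfl
    | succ m ih =>
      rw [← add_assoc, hg, Function.update_of_ne (by omega), ih]
  have hdiag : ∀ n u, u ≤ p + n → g u u = g n u := by
    intro n u hu
    rcases le_total u n with h | h
    · obtain ⟨m, rfl⟩ := Nat.exists_eq_add_of_le h
      exact (hstab u m u (by omega)).symm
    · obtain ⟨m, rfl⟩ := Nat.exists_eq_add_of_le h
      exact hstab n m _ hu
  refine ⟨fun u => g u u, fun u hu => hdiag 0 u hu, fun t ht => ?_⟩
  obtain ⟨n, rfl⟩ := Nat.exists_eq_add_of_le ht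
  change g (p + n + 1) (p + n + 1) = _
  rw [hdiag (n + 1) (p + n + 1) (by omega), hg, Function.update_self]
  exact hf fun u hu => (hdiag n u hu).symm

/-- A finite path extends to a play in which player `j` moves according to `c` and the other
players according to `S`. -/
lemma exists_follows {S : (ℕ → V) → ℕ → V} (hS : G.IsResponse S) (j : ι) {c : V → V}
    (hc : ∀ v, G.E v (c v)) {π : ℕ → V} {p : ℕ} (h0 : π 0 = v₀)
    (hπ : ∀ t < p, G.E (π t) (π (t + 1))) :
    ∃ π', G.IsPlay v₀ π' ∧ (∀ u ≤ p, π' u = π u) ∧ G.Follows j S p π' ∧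
      ∀ t, p ≤ t → G.owner (π' t) = j → π' (t + 1) = c (π' t) := by
  obtain ⟨π', h1, h2⟩ := exists_extension
    (f := fun π t => if G.owner (π t) = j then c (π t) else S π t)
    (by intro π π' t h
        simp only [h t le_rfl, hS.congr h]) π p
  refine ⟨π', ⟨by rw [h1 0 (Nat.zero_le _), h0], fun t => ?_⟩, h1, fun t ht ho => ?_,
    fun t ht ho => ?_⟩
  · rcases lt_or_ge t p with ht | ht
    · rw [h1 t ht.le, h1 (t + 1) ht]
      exact hπ t ht
    · rw [h2 t ht]
      split_ifs
      · exact hc _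
      · exact hS.edge _ _
  · rw [h2 t ht, if_neg ho]
  · rw [h2 t ht, if_pos ho]

lemma IsDeviation.exists_continuation {ρ π : ℕ → V} {j : ι} {S : (ℕ → V) → ℕ → V} {k p : ℕ}
    (hS : G.IsResponse S) {c : V → V} (hc : ∀ v, G.E v (c v)) (h0 : π 0 = v₀)
    (hπ : ∀ t < p, G.E (π t) (π (t + 1))) (hagree : ∀ u ≤ k, π u = ρ u)
    (howner : G.owner (ρ k) = j) (hne : π (k + 1) ≠ ρ (k + 1)) (hkp : k < p)
    (hfol : ∀ t, k + 1 ≤ t → t < p → G.owner (π t) ≠ j → π (t + 1) = S π t) :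
    ∃ π', G.IsDeviation v₀ ρ j S k π' ∧ (∀ u ≤ p, π' u = π u) ∧
      ∀ t, p ≤ t → G.owner (π' t) = j → π' (t + 1) = c (π' t) := by
  obtain ⟨π', hplay, hag, hf, hcc⟩ := exists_follows hS j hc h0 hπ
  refine ⟨π', ⟨hplay, fun u hu => ?_, howner, ?_, fun t ht ho => ?_⟩, hag, hcc⟩
  · rw [hag u (by omega), hagree u hu]
  · rwa [hag _ hkp]
  · rcases lt_or_ge t p with htp | htp
    · rw [hag (t + 1) htp, hS.congr fun u hu => hag u (by omega)]
      refine hfol t ht htp ?_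
      rwa [← hag t htp.le]
    · exact hf t htp ho

/-! ### Controllable predecessors and attractors of the coalition against `j` -/

/-- The vertices from which the coalition against `j` forces the next vertex to lie in `Y`. -/
def cpre (G : QRGame ι V) (j : ι) (Y : Set V) : Set V :=
  {v | (G.owner v = j → ∀ w, G.E v w → w ∈ Y) ∧ (G.owner v ≠ j → ∃ w, G.E v w ∧ w ∈ Y)}

lemma cpre_mono (j : ι) {X Y : Set V} (h : X ⊆ Y) : G.cpre j X ⊆ G.cpre j Y :=
  fun _ hv => ⟨fun ho w hw => h (hv.1 ho w hw),
    fun ho => (hv.2 ho).imp fun _ hw => ⟨hw.1, h hw.2⟩⟩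

/-- The vertices from which the coalition against `j` can avoid `B` forever. -/
def safe (G : QRGame ι V) (j : ι) (B : Set V) : Set V :=
  ⋃₀ {X | X ⊆ Bᶜ ∩ G.cpre j X}

lemma subset_safe {j : ι} {B X : Set V} (h : X ⊆ Bᶜ ∩ G.cpre j X) : X ⊆ G.safe j B :=
  Set.subset_sUnion_of_mem h

lemma safe_subset (j : ι) (B : Set V) : G.safe j B ⊆ Bᶜ ∩ G.cpre j (G.safe j B) :=
  Set.sUnion_subset fun _ hX => hX.trans
    (Set.inter_subset_inter_right _ (cpre_mono j (subset_safe hX)))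

/-- The vertices of `W` from which the coalition against `j` can force a visit of `T` within
`n` steps while staying in `W`. -/
def attr (G : QRGame ι V) (j : ι) (W T : Set V) : ℕ → Set V
  | 0 => W ∩ T
  | n + 1 => attr G j W T n ∪ (W ∩ G.cpre j (attr G j W T n))

lemma attr_mono (j : ι) (W T : Set V) : Monotone (G.attr j W T) :=
  monotone_nat_of_le_succ fun _ => Set.subset_union_left

lemma attr_subset (j : ι) (W T : Set V) (n : ℕ) : G.attr j W T n ⊆ W := by
  induction n with
  | zero => exact Set.inter_subset_left
  | succ n ih => exact Set.union_subset ih Set.inter_subset_left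

lemma mem_cpre_of_mem_attr_succ {j : ι} {W T : Set V} {n : ℕ} {v : V}
    (hv : v ∈ G.attr j W T (n + 1)) (hT : v ∉ T) : v ∈ G.cpre j (G.attr j W T n) := by
  induction n with
  | zero =>
    rcases hv with hv | hv
    · exact absurd hv.2 hT
    · exact hv.2
  | succ n ih =>
    rcases hv with hv | hv
    · exact cpre_mono j (attr_mono j W T n.le_succ) (ih hv)
    · exact hv.2

lemma attr_card [Fintype V] [Nonempty V] (j : ι) (W T : Set V) :
    G.attr j W T (Fintype.card V - 1 + 1) = G.attr j W T (Fintype.card V - 1) := by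
  have hstep : ∀ n, G.attr j W T (n + 1) = G.attr j W T n ∨
      n + 2 ≤ (G.attr j W T (n + 1)).ncard := by
    intro n
    induction n with
    | zero =>
      by_cases h : G.attr j W T 1 = G.attr j W T 0
      · exact Or.inl h
      · right
        have hlt := Set.ncard_lt_ncard
          ((attr_mono j W T (Nat.zero_le 1)).lt_of_ne (Ne.symm h)) (Set.toFinite _)
        rcases Set.eq_empty_or_nonempty (G.attr j W T 0) with h0 | h0
        · exfalso
          apply h
          rw [h0, Set.eq_empty_iff_forall_notMem]
          intro v hv
          have hT : v ∉ T := fun hT => by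
            have : v ∈ G.attr j W T 0 := ⟨attr_subset j W T 1 hv, hT⟩
            simp [h0] at this
          have := mem_cpre_of_mem_attr_succ hv hT
          rw [h0] at this
          by_cases ho : G.owner v = j
          · obtain ⟨w, hw⟩ := G.total v
            exact this.1 ho w hw
          · obtain ⟨w, _, hw⟩ := this.2 ho
            exact hw
        · have := (Set.ncard_pos (Set.toFinite _)).2 h0
          change 2 ≤ (G.attr j W T 1).ncard
          omega
    | succ n ih =>
      rcases ih with ih | ih
      · left
        change G.attr j W T (n + 1) ∪ (W ∩ G.cpre j (G.attr j W T (n + 1))) = _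
        rw [ih]
        exact ih
      · by_cases h : G.attr j W T (n + 1 + 1) = G.attr j W T (n + 1)
        · exact Or.inl h
        · right
          have hlt := Set.ncard_lt_ncard
            ((attr_mono j W T (n + 1).le_succ).lt_of_ne (Ne.symm h)) (Set.toFinite _)
          simp only [Nat.succ_eq_add_one] at hlt
          omega
  have hpos := Fintype.card_pos (α := V)
  refine (hstep (Fintype.card V - 1)).resolve_right fun h => ?_
  have := Set.ncard_le_card (G.attr j W T (Fintype.card V - 1 + 1))
  rw [Nat.card_eq_fintype_card] at this
  omega

/-- A positional strategy of the coalition that stays in `W` and decreases the distance to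
`T`. -/
lemma exists_attr_strategy {j : ι} {W : Set V} (T : Set V) (hW : W ⊆ G.cpre j W) :
    ∃ g : V → V, (∀ v, G.E v (g v)) ∧ ∀ v ∈ W, G.owner v ≠ j → g v ∈ W ∧
      ∀ n, v ∈ G.attr j W T (n + 1) → v ∉ T → g v ∈ G.attr j W T n := by
  have key : ∀ v, ∃ w, G.E v w ∧ (v ∈ W → G.owner v ≠ j → w ∈ W ∧
      ∀ n, v ∈ G.attr j W T (n + 1) → v ∉ T → w ∈ G.attr j W T n) := by
    intro v
    by_cases hv : v ∈ W ∧ G.owner v ≠ j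
    · by_cases hn : (∃ n, v ∈ G.attr j W T (n + 1)) ∧ v ∉ T
      · obtain ⟨hn, hT⟩ := hn
        obtain ⟨w, hw, hwa⟩ :=
          (mem_cpre_of_mem_attr_succ (Nat.find_spec hn) hT).2 hv.2
        exact ⟨w, hw, fun _ _ => ⟨attr_subset _ _ _ _ hwa, fun n h _ =>
          attr_mono j W T (Nat.find_min' hn h) hwa⟩⟩
      · obtain ⟨w, hw, hwW⟩ := (hW hv.1).2 hv.2
        exact ⟨w, hw, fun _ _ => ⟨hwW, fun n h hT => absurd ⟨⟨n, h⟩, hT⟩ hn⟩⟩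
    · obtain ⟨w, hw⟩ := G.total v
      exact ⟨w, hw, fun h1 h2 => absurd ⟨h1, h2⟩ hv⟩
  choose g hg using key
  exact ⟨g, fun v => (hg v).1, fun v => (hg v).2⟩

lemma exists_visit_of_mem_attr {j : ι} {W T : Set V} {g : V → V}
    (hg : ∀ v ∈ W, G.owner v ≠ j → g v ∈ W ∧
      ∀ n, v ∈ G.attr j W T (n + 1) → v ∉ T → g v ∈ G.attr j W T n)
    {π : ℕ → V} (hπ : ∀ t, G.E (π t) (π (t + 1))) {n p : ℕ}
    (hf : ∀ t, p ≤ t → G.owner (π t) ≠ j → π (t + 1) = g (π t))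
    (hp : π p ∈ G.attr j W T n) : ∃ t, p ≤ t ∧ t ≤ p + n ∧ π t ∈ T := by
  induction n generalizing p with
  | zero => exact ⟨p, le_rfl, le_rfl, hp.2⟩
  | succ n ih =>
    by_cases hT : π p ∈ T
    · exact ⟨p, le_rfl, by omega, hT⟩
    · have hnext : π (p + 1) ∈ G.attr j W T n := by
        by_cases ho : G.owner (π p) = j
        · exact (mem_cpre_of_mem_attr_succ hp hT).1 ho _ (hπ p)
        · rw [hf p le_rfl ho]
          exact (hg _ (attr_subset _ _ _ _ hp) ho).2 n hp hT
      obtain ⟨t, h1, h2, h3⟩ := ih (fun t ht => hf t (by omega)) hnext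
      exact ⟨t, by omega, by omega, h3⟩

lemma mem_of_follows_positional {j : ι} {W : Set V} (hW : W ⊆ G.cpre j W) {g : V → V}
    (hg : ∀ v ∈ W, G.owner v ≠ j → g v ∈ W) {π : ℕ → V}
    (hπ : ∀ t, G.E (π t) (π (t + 1))) {p : ℕ}
    (hf : ∀ t, p ≤ t → G.owner (π t) ≠ j → π (t + 1) = g (π t)) (hp : π p ∈ W) :
    ∀ t, p ≤ t → π t ∈ W := by
  intro t ht
  induction t, ht using Nat.le_induction with
  | base => exact hp
  | succ t ht ih =>
    by_cases ho : G.owner (π t) = j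
    · exact (hW ih).1 ho _ (hπ t)
    · rw [hf t ht ho]
      exact hg _ ih ho

/-! ### Removing a cycle and switching to an attractor strategy -/

lemma mem_safe_of_isDeviation {ρ : ℕ → V} {S : ι → (ℕ → V) → ℕ → V}
    (hS : ∀ j, G.IsResponse (S j)) (hdet : G.Deters v₀ ⊤ ρ S) {j : ι} {k : ℕ} {π : ℕ → V}
    (hdev : G.IsDeviation v₀ ρ j (S j) k π) {t : ℕ} (ht : k < t) :
    π t ∈ G.safe j {v | v ∈ G.F j ∧ G.horizonCost ⊤ j ρ = ⊤} := by
  refine subset_safe (X := {w | ∃ k π t, G.IsDeviation v₀ ρ j (S j) k π ∧ k < t ∧ π t = w})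
    ?_ ⟨k, π, t, hdev, ht, rfl⟩
  rintro w ⟨k, π, t, hdev, ht, rfl⟩
  refine ⟨?_, fun ho w hw => ?_, fun ho => ?_⟩
  · rintro ⟨hF, htop⟩
    refine hdet j k π hdev (Or.inl ?_)
    simp only [htop]
    exact horizonCost_lt_iff.2 ⟨t, ENat.natCast_lt_top _, hF, ENat.natCast_lt_top _⟩
  · choose c hc using G.total
    have hupd : ∀ u ≤ t, Function.update π (t + 1) w u = π u := fun u hu =>
      Function.update_of_ne (by omega) _ _
    obtain ⟨π', hdev', hag, -⟩ := IsDeviation.exists_continuation (p := t + 1)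
      (v₀ := v₀) (π := Function.update π (t + 1) w) (ρ := ρ) (k := k) (hS j) hc
      (by exact hdev.play.1)
      (fun u hu => by
        rcases Nat.lt_succ_iff_lt_or_eq.1 hu with hu | rfl
        · rw [hupd u hu.le, hupd _ hu]
          exact hdev.play.2 u
        · rw [hupd u le_rfl, Function.update_self]
          exact hw)
      (fun u hu => by rw [hupd u (by omega)]; exact hdev.agree u hu) hdev.owner
      (by rw [hupd _ ht]; exact hdev.ne) (by omega)
      (fun u hu hut hou => by
        have hne : u ≠ t := fun h => hou (by rw [h, hupd t le_rfl, ho])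
        rw [hupd u (by omega)] at hou
        rw [hupd _ (by omega), (hS j).congr fun x hx => hupd x (by omega)]
        exact hdev.follows u hu hou)
    exact ⟨k, π', t + 1, hdev', by omega, by rw [hag _ le_rfl, Function.update_self]⟩
  · exact ⟨π (t + 1), hdev.play.2 t, k, π, t + 1, hdev, by omega, rfl⟩

/-- If the coalition cannot force a visit of `T` from `π p`, then some deviation sharing the
prefix of `π` up to time `p` never visits `T` from time `p` on. -/
lemma exists_avoiding_of_notMem_attr [Fintype V] {ρ : ℕ → V} {S : ι → (ℕ → V) → ℕ → V}
    (hS : ∀ j, G.IsResponse (S j)) (hdet : G.Deters v₀ ⊤ ρ S) {j : ι} {k p : ℕ} {π : ℕ → V}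
    (hdev : G.IsDeviation v₀ ρ j (S j) k π) (hkp : k < p) (T : Set V)
    (hp : π p ∉ G.attr j (G.safe j {v | v ∈ G.F j ∧ G.horizonCost ⊤ j ρ = ⊤}) T
      (Fintype.card V - 1)) :
    ∃ π', G.IsDeviation v₀ ρ j (S j) k π' ∧ (∀ u ≤ p, π' u = π u) ∧
      ∀ t, p ≤ t → π' t ∉ T := by
  set W := G.safe j {v | v ∈ G.F j ∧ G.horizonCost ⊤ j ρ = ⊤}
  set A := G.attr j W T (Fintype.card V - 1) with hA
  have : Nonempty V := ⟨v₀⟩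
  have hclosed : W ∩ G.cpre j A ⊆ A := by
    rw [hA, ← attr_card, attr_card]
    nth_rewrite 2 [← attr_card]
    exact Set.subset_union_right
  have hc : ∀ v, ∃ w, G.E v w ∧ ((∃ w', G.E v w' ∧ w' ∉ A) → w ∉ A) := by
    intro v
    by_cases h : ∃ w', G.E v w' ∧ w' ∉ A
    · obtain ⟨w, h1, h2⟩ := h
      exact ⟨w, h1, fun _ => h2⟩
    · obtain ⟨w, hw⟩ := G.total v
      exact ⟨w, hw, fun h' => absurd h' h⟩
  choose c hcE hcA using hc
  obtain ⟨π', hdev', hag, hown⟩ := IsDeviation.exists_continuation (v₀ := v₀) (p := p) (hS j) hcE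
    hdev.play.1 (fun t _ => hdev.play.2 t) hdev.agree hdev.owner hdev.ne hkp
    (fun t ht _ => hdev.follows t ht)
  have hW : ∀ t, p ≤ t → π' t ∈ W := fun t ht =>
    mem_safe_of_isDeviation hS hdet hdev' (by omega)
  have hnA : ∀ t, p ≤ t → π' t ∉ A := by
    intro t ht
    induction t, ht using Nat.le_induction with
    | base => rwa [hag p le_rfl]
    | succ t ht ih =>
      by_cases ho : G.owner (π' t) = j
      · rw [hown t ht ho]
        apply hcA
        by_contra! hall
        exact ih (hclosed ⟨hW t ht, fun _ => hall, fun h => absurd ho h⟩)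
      · intro hmem
        exact ih (hclosed ⟨hW t ht, fun h => absurd h ho,
          fun _ => ⟨_, hdev'.play.2 t, hmem⟩⟩)
  refine ⟨π', hdev', hag, fun t ht hT => hnA t ht ?_⟩
  exact attr_mono j W T (Nat.zero_le _) ⟨hW t ht, hT⟩

/-- The sequence `π` with the segment between the times `p` and `q` removed. -/
def cut (p q : ℕ) (π : ℕ → V) (t : ℕ) : V :=
  if t ≤ p then π t else π (t + (q - p))

/-- The sequence that follows `ρ` up to time `q` and then `π` from time `p` on. -/
def splice (p q : ℕ) (ρ π : ℕ → V) (t : ℕ) : V :=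
  if t ≤ q then ρ t else π (t - (q - p))

lemma cut_of_le {p q t : ℕ} (π : ℕ → V) (h : t ≤ p) : cut p q π t = π t := if_pos h

lemma cut_of_ge {p q t : ℕ} {π : ℕ → V} (hpq : p ≤ q) (hloop : π p = π q) (h : p ≤ t) :
    cut p q π t = π (t + (q - p)) := by
  rcases h.eq_or_lt with rfl | h
  · rw [cut_of_le π le_rfl, hloop, Nat.add_sub_cancel' hpq]
  · exact if_neg (by omega)

lemma splice_of_le {p q t : ℕ} (ρ π : ℕ → V) (h : t ≤ q) : splice p q ρ π t = ρ t := if_pos h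

lemma splice_add {p q t : ℕ} {ρ π : ℕ → V} (hpq : p ≤ q) (hloop : ρ p = ρ q)
    (hπ : π p = ρ p) (h : p ≤ t) : splice p q ρ π (t + (q - p)) = π t := by
  rcases h.eq_or_lt with rfl | h
  · rw [Nat.add_sub_cancel' hpq, splice_of_le ρ π le_rfl, hπ, hloop]
  · rw [splice, if_neg (by omega), Nat.add_sub_cancel]

lemma IsPlay.cut {ρ : ℕ → V} (hρ : G.IsPlay v₀ ρ) {p q : ℕ} (hpq : p ≤ q)
    (hloop : ρ p = ρ q) : G.IsPlay v₀ (cut p q ρ) := by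
  refine ⟨by rw [cut_of_le ρ (Nat.zero_le _), hρ.1], fun t => ?_⟩
  rcases lt_or_ge t p with h | h
  · rw [cut_of_le ρ h.le, cut_of_le ρ h]
    exact hρ.2 t
  · rw [cut_of_ge hpq hloop h, cut_of_ge hpq hloop (by omega), Nat.add_right_comm]
    exact hρ.2 _

/-- The responses to deviations from `cut p q ρ`: a deviation after time `p` is answered as the
corresponding deviation from `ρ`, and an earlier one as before until time `p`, when the coalition
switches to the positional strategy `g j` if the current vertex belongs to `A j`. -/
noncomputable def switchResponse (p q : ℕ) (ρ : ℕ → V) (S : ι → (ℕ → V) → ℕ → V)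
    (g : ι → V → V) (A : ι → Set V) (j : ι) (π : ℕ → V) (t : ℕ) : V :=
  if p ≤ t ∧ ∀ u ≤ p, π u = ρ u then S j (splice p q ρ π) (t + (q - p))
  else if p ≤ t ∧ π p ∈ A j then g j (π t)
  else S j π t

lemma isResponse_switchResponse {p q : ℕ} {ρ : ℕ → V} {S : ι → (ℕ → V) → ℕ → V}
    {g : ι → V → V} {A : ι → Set V} (hpq : p ≤ q) (hloop : ρ p = ρ q)
    (hS : ∀ j, G.IsResponse (S j)) (hg : ∀ j v, G.E v (g j v)) (j : ι) :
    G.IsResponse (switchResponse p q ρ S g A j) where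
  congr := by
    intro π π' t h
    have h1 : (p ≤ t ∧ ∀ u ≤ p, π u = ρ u) ↔ (p ≤ t ∧ ∀ u ≤ p, π' u = ρ u) :=
      and_congr_right fun ht => forall₂_congr fun u hu => by rw [h u (hu.trans ht)]
    have h2 : (p ≤ t ∧ π p ∈ A j) ↔ (p ≤ t ∧ π' p ∈ A j) :=
      and_congr_right fun ht => by rw [h p ht]
    simp only [switchResponse, h1, h2, h t le_rfl, (hS j).congr h]
    split_ifs with h3
    · refine (hS j).congr fun u hu => ?_
      unfold splice
      split_ifs
      · rfl
      · exact h _ (by omega)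
    · rfl
    · rfl
  edge := by
    intro π t
    unfold switchResponse
    split_ifs with h1 h2
    · have := (hS j).edge (splice p q ρ π) (t + (q - p))
      rwa [splice_add hpq hloop (h1.2 p le_rfl) h1.1] at this
    · exact hg j _
    · exact (hS j).edge _ _

lemma IsPlay.splice {ρ π : ℕ → V} (hρ : G.IsPlay v₀ ρ) (hE : ∀ t, G.E (π t) (π (t + 1)))
    {p q : ℕ} (hpq : p ≤ q) (hloop : ρ p = ρ q) (hπ : π p = ρ p) :
    G.IsPlay v₀ (splice p q ρ π) := by
  refine ⟨by rw [splice_of_le ρ π (Nat.zero_le _), hρ.1], fun t => ?_⟩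
  rcases lt_or_ge t q with h | h
  · rw [splice_of_le ρ π h.le, splice_of_le ρ π h]
    exact hρ.2 t
  · obtain ⟨s, hs, rfl⟩ : ∃ s, p ≤ s ∧ t = s + (q - p) := ⟨t - (q - p), by omega, by omega⟩
    rw [splice_add hpq hloop hπ hs, Nat.add_right_comm, splice_add hpq hloop hπ (by omega)]
    exact hE s

lemma horizonCost_cut_of_le {ρ : ℕ → V} {p : ℕ} (q : ℕ) {N : ℕ∞} {i : ι}
    (hN : (p : ℕ∞) < N) (h : G.horizonCost ⊤ i ρ ≤ p) :
    G.horizonCost N i (cut p q ρ) = G.horizonCost ⊤ i ρ :=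
  horizonCost_eq_of_agree (fun _ hu => cut_of_le ρ hu) (ENat.natCast_lt_top p) hN h

lemma horizonCost_cut_add {ρ : ℕ → V} {p q : ℕ} {i : ι} (hpq : p ≤ q) (hloop : ρ p = ρ q)
    (h : (q : ℕ∞) ≤ G.horizonCost ⊤ i ρ) :
    G.horizonCost ⊤ i ρ = G.horizonCost ⊤ i (cut p q ρ) + (q - p : ℕ) := by
  have hq : ∀ l, ρ l ∈ G.F i → q ≤ l := fun l hl => by
    exact_mod_cast le_horizonCost_iff.1 h l (ENat.natCast_lt_top _) hl
  refine horizonCost_top_eq_add (p := p) (fun l hl => ?_) (fun l hl => ?_)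
    fun t ht => (cut_of_ge hpq hloop ht).symm
  · have := hq l hl
    omega
  · by_contra! hlp
    rw [cut_of_le ρ hlp.le] at hl
    have := hq l hl
    omega

/-- Deviations from `cut p q ρ` after time `p` are deterred because the corresponding
deviations from `ρ` are. -/
lemma not_prec_of_late_deviation {ρ : ℕ → V} {S : ι → (ℕ → V) → ℕ → V}
    (hρ : G.IsPlay v₀ ρ) (hdet : G.Deters v₀ ⊤ ρ S) {p q : ℕ}
    (hpq : p ≤ q) (hloop : ρ p = ρ q)
    (hgap : ∀ i, G.horizonCost ⊤ i ρ ≤ p ∨ (q + 1 : ℕ) ≤ G.horizonCost ⊤ i ρ)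
    {g : ι → V → V} {A : ι → Set V} {N : ℕ∞} (hN : (p : ℕ∞) < N)
    (hinf : N = ⊤ ∨ ∀ i, G.horizonCost ⊤ i ρ ≤ p ∨ G.horizonCost ⊤ i ρ = ⊤)
    {j : ι} {k : ℕ} {π : ℕ → V} (hpk : p ≤ k)
    (hdev : G.IsDeviation v₀ (cut p q ρ) j (switchResponse p q ρ S g A j) k π) :
    ¬ Prec j (fun i => G.horizonCost N i (cut p q ρ)) (fun i => G.horizonCost N i π) := by
  have hπ : ∀ u ≤ p, π u = ρ u := fun u hu => by
    rw [hdev.agree u (hu.trans hpk), cut_of_le ρ hu]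
  have hsp : ∀ t, p ≤ t → splice p q ρ π (t + (q - p)) = π t := fun t ht =>
    splice_add hpq hloop (hπ p le_rfl) ht
  have hdev' : G.IsDeviation v₀ ρ j (S j) (k + (q - p)) (splice p q ρ π) := by
    refine ⟨hρ.splice hdev.play.2 hpq hloop (hπ p le_rfl), fun u hu => ?_, ?_, ?_,
      fun t ht ho => ?_⟩
    · rcases le_or_gt u q with h | h
      · exact splice_of_le ρ π h
      · obtain ⟨s, hs, rfl⟩ : ∃ s, p ≤ s ∧ u = s + (q - p) := ⟨u - (q - p), by omega, by omega⟩
        rw [hsp s hs, hdev.agree s (by omega), cut_of_ge hpq hloop hs]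
    · rw [← cut_of_ge hpq hloop hpk]
      exact hdev.owner
    · rw [Nat.add_right_comm, hsp _ (by omega), ← cut_of_ge hpq hloop (by omega)]
      exact hdev.ne
    · obtain ⟨s, hs, rfl⟩ : ∃ s, k + 1 ≤ s ∧ t = s + (q - p) :=
        ⟨t - (q - p), by omega, by omega⟩
      rw [hsp s (by omega)] at ho
      rw [Nat.add_right_comm, hsp _ (by omega), hdev.follows s hs ho, switchResponse,
        if_pos ⟨by omega, hπ⟩]
  have hlow : ∀ i, G.horizonCost ⊤ i ρ ≤ p →
      G.horizonCost N i (cut p q ρ) = G.horizonCost ⊤ i ρ ∧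
      G.horizonCost N i π = G.horizonCost ⊤ i ρ ∧
      G.horizonCost ⊤ i (splice p q ρ π) = G.horizonCost ⊤ i ρ := fun i hi =>
    ⟨horizonCost_cut_of_le q hN hi, horizonCost_eq_of_agree hπ (ENat.natCast_lt_top p) hN hi,
      horizonCost_eq_of_agree (fun u hu => splice_of_le ρ π (hu.trans hpq))
        (ENat.natCast_lt_top p) (ENat.natCast_lt_top p) hi⟩
  have hhigh : ∀ i, (q + 1 : ℕ) ≤ G.horizonCost ⊤ i ρ →
      G.horizonCost ⊤ i ρ = G.horizonCost ⊤ i (cut p q ρ) + (q - p : ℕ) ∧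
      G.horizonCost ⊤ i (splice p q ρ π) = G.horizonCost ⊤ i π + (q - p : ℕ) := fun i hi => by
    have hq : ∀ l, ρ l ∈ G.F i → q + 1 ≤ l := fun l hl => by
      exact_mod_cast le_horizonCost_iff.1 hi l (ENat.natCast_lt_top _) hl
    refine ⟨horizonCost_cut_add hpq hloop (le_trans (by exact_mod_cast q.le_succ) hi),
      horizonCost_top_eq_add (p := p) (fun l hl => ?_) (fun l hl => ?_) hsp⟩
    · by_contra! h
      rw [splice_of_le ρ π (by omega)] at hl
      have := hq l hl
      omega
    · by_contra! h
      rw [hπ l h.le] at hl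
      have := hq l hl
      omega
  have hne : ((q - p : ℕ) : ℕ∞) ≠ ⊤ := ENat.natCast_ne_top _
  intro hprec
  apply hdet j _ _ hdev'
  rcases hinf with rfl | hinf
  · have hle : ∀ i, G.horizonCost ⊤ i ρ ≤ G.horizonCost ⊤ i (splice p q ρ π) ↔
        G.horizonCost ⊤ i (cut p q ρ) ≤ G.horizonCost ⊤ i π := fun i => by
      rcases hgap i with hi | hi
      · obtain ⟨h1, h2, h3⟩ := hlow i hi
        rw [h1, h2, h3]
      · obtain ⟨h1, h2⟩ := hhigh i hi
        rw [h1, h2, ENat.add_le_add_iff_right hne]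
    have hge : ∀ i, G.horizonCost ⊤ i (splice p q ρ π) ≤ G.horizonCost ⊤ i ρ ↔
        G.horizonCost ⊤ i π ≤ G.horizonCost ⊤ i (cut p q ρ) := fun i => by
      rcases hgap i with hi | hi
      · obtain ⟨h1, h2, h3⟩ := hlow i hi
        rw [h1, h2, h3]
      · obtain ⟨h1, h2⟩ := hhigh i hi
        rw [h1, h2, ENat.add_le_add_iff_right hne]
    simpa only [Prec, ← not_le, le_antisymm_iff, hle, hge] using hprec
  · rcases hprec with h | ⟨-, -, i, h⟩
    · left
      rcases hinf j with hj | hj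
      · obtain ⟨h1, h2, -⟩ := hlow j hj
        exact absurd h (by simp only [h1, h2, lt_irrefl, not_false_eq_true])
      · have h' : G.horizonCost ⊤ j π < ⊤ :=
          (horizonCost_anti le_top j π).trans_lt (lt_of_lt_of_le h le_top)
        have h'' := (hhigh j (le_top.trans_eq hj.symm)).2
        simp only [h'', hj]
        exact WithTop.add_lt_top.2 ⟨h', ENat.natCast_lt_top _⟩
    · exfalso
      rcases hinf i with hi | hi
      · obtain ⟨h1, h2, -⟩ := hlow i hi
        exact absurd h (by simp only [h1, h2, lt_irrefl, not_false_eq_true])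
      · have h1 := (hhigh i (le_top.trans_eq hi.symm)).1
        have h2 : G.horizonCost ⊤ i (cut p q ρ) = ⊤ := by
          by_contra hc
          rw [hi] at h1
          exact absurd h1.symm (WithTop.add_ne_top.2 ⟨hc, hne⟩)
        have h3 : G.horizonCost N i (cut p q ρ) = ⊤ :=
          top_le_iff.1 (h2 ▸ horizonCost_anti le_top i _)
        exact absurd h (by simp only [h3, not_top_lt, not_false_eq_true])

lemma le_horizonCost_cut {ρ : ℕ → V} {p q n : ℕ} {i : ι} (hpq : p ≤ q) (hloop : ρ p = ρ q)
    (N : ℕ∞) (h : (q + n : ℕ) ≤ G.horizonCost ⊤ i ρ) :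
    (p + n : ℕ) ≤ G.horizonCost N i (cut p q ρ) := by
  refine le_trans ?_ (horizonCost_anti le_top i _)
  rw [horizonCost_cut_add hpq hloop (le_trans (by exact_mod_cast Nat.le_add_right q n) h)] at h
  refine (ENat.add_le_add_iff_right (ENat.natCast_ne_top (q - p))).1 (le_trans (le_of_eq ?_) h)
  norm_cast
  omega

/-- Deviations from `cut p q ρ` before time `p` are deterred if the coalition switches at time
`p` to an attractor strategy for the goals that `ρ` has not visited by then. -/
lemma not_prec_of_early_deviation [Fintype V] {ρ : ℕ → V} {S : ι → (ℕ → V) → ℕ → V}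
    (hS : ∀ j, G.IsResponse (S j)) (hdet : G.Deters v₀ ⊤ ρ S) {p q : ℕ}
    (hpq : p ≤ q) (hloop : ρ p = ρ q)
    (hgap : ∀ i, G.horizonCost ⊤ i ρ ≤ p ∨
      (q + Fintype.card V : ℕ) ≤ G.horizonCost ⊤ i ρ)
    {N : ℕ∞} (hN : (p + Fintype.card V : ℕ) ≤ N)
    (hinf : (N = ⊤ ∧ p < q) ∨ ∀ i, G.horizonCost ⊤ i ρ ≤ p ∨ G.horizonCost ⊤ i ρ = ⊤)
    {g : ι → V → V} {A : ι → Set V} {j : ι} {W T : Set V}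
    (hW : W = G.safe j {v | v ∈ G.F j ∧ G.horizonCost ⊤ j ρ = ⊤})
    (hT : T = {v | ∃ i, ¬ G.horizonCost ⊤ i ρ ≤ p ∧ v ∈ G.F i})
    (hg : ∀ v ∈ W, G.owner v ≠ j → g j v ∈ W ∧
      ∀ n, v ∈ G.attr j W T (n + 1) → v ∉ T → g j v ∈ G.attr j W T n)
    (hA : A j = {v | v ∈ G.attr j W T (Fintype.card V - 1) ∧
      (G.horizonCost ⊤ j ρ ≤ p ∨ G.horizonCost ⊤ j ρ = ⊤)})
    {k : ℕ} {π : ℕ → V} (hkp : k < p)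
    (hdev : G.IsDeviation v₀ (cut p q ρ) j (switchResponse p q ρ S g A j) k π) :
    ¬ Prec j (fun i => G.horizonCost N i (cut p q ρ)) (fun i => G.horizonCost N i π) := by
  have hcard : 0 < Fintype.card V := Fintype.card_pos_iff.2 ⟨v₀⟩
  have hpN : (p : ℕ∞) < N :=
    lt_of_lt_of_le (by exact_mod_cast Nat.lt_add_of_pos_right hcard) hN
  have hag : ∀ u ≤ k, π u = ρ u := fun u hu => by
    rw [hdev.agree u hu, cut_of_le ρ (by omega)]
  have hown : G.owner (ρ k) = j := by
    rw [← cut_of_le (q := q) ρ hkp.le]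
    exact hdev.owner
  have hne : π (k + 1) ≠ ρ (k + 1) := by
    rw [← cut_of_le (p := p) (q := q) ρ hkp]
    exact hdev.ne
  have hresp : ∀ t, switchResponse p q ρ S g A j π t =
      if p ≤ t ∧ π p ∈ A j then g j (π t) else S j π t := fun t =>
    if_neg fun h => hne (h.2 (k + 1) hkp)
  have hfol : ∀ t, k + 1 ≤ t → t < p → G.owner (π t) ≠ j → π (t + 1) = S j π t :=
    fun t ht htp ho => by
      rw [hdev.follows t ht ho, hresp, if_neg fun h => absurd h.1 (by omega)]
  have hlow : ∀ i, G.horizonCost ⊤ i ρ ≤ p →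
      G.horizonCost N i (cut p q ρ) = G.horizonCost ⊤ i ρ := fun i hi =>
    horizonCost_cut_of_le q hpN hi
  have hhigh : ∀ i, ¬ G.horizonCost ⊤ i ρ ≤ p →
      (p + Fintype.card V : ℕ) ≤ G.horizonCost N i (cut p q ρ) := fun i hi =>
    le_horizonCost_cut hpq hloop N ((hgap i).resolve_left hi)
  by_cases hmem : π p ∈ A j
  · rw [hA] at hmem
    obtain ⟨hattr, hj⟩ := hmem
    have hpos : ∀ t, p ≤ t → G.owner (π t) ≠ j → π (t + 1) = g j (π t) := fun t ht ho => by
      rw [hdev.follows t (by omega) ho, hresp, if_pos ⟨ht, hA ▸ ⟨hattr, hj⟩⟩]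
    choose c hc using G.total
    obtain ⟨π', hdev', hag', -⟩ := IsDeviation.exists_continuation (v₀ := v₀) (p := p) (hS j) hc
      hdev.play.1 (fun t _ => hdev.play.2 t) hag hown hne hkp hfol
    rintro (h | ⟨-, h, -⟩)
    · obtain ⟨l, -, hl, hlt⟩ := horizonCost_lt_iff.1 h
      have hlow' : ∀ hlp : l ≤ p, (l : ℕ∞) < G.horizonCost ⊤ j ρ → False := fun hlp hlt' =>
        hdet j k π' hdev' (Or.inl (horizonCost_lt_iff.2
          ⟨l, ENat.natCast_lt_top l, by rwa [hag' l hlp], hlt'⟩))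
      rcases hj with hj | hj
      · simp only [hlow j hj] at hlt
        exact hlow' (by exact_mod_cast (hlt.trans_le hj).le) hlt
      · rcases le_or_gt l p with hlp | hlp
        · exact hlow' hlp (lt_of_lt_of_eq (ENat.natCast_lt_top l) hj.symm)
        · have hsub := safe_subset (G := G) j {v | v ∈ G.F j ∧ G.horizonCost ⊤ j ρ = ⊤}
          rw [← hW] at hsub
          have hlW := mem_of_follows_positional (fun v hv => (hsub hv).2)
            (fun v hv ho => (hg v hv ho).1) hdev.play.2 hpos (attr_subset _ _ _ _ hattr) l hlp.le
          exact (hsub hlW).1 ⟨hl, hj⟩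
    · obtain ⟨t, -, ht, htT⟩ := exists_visit_of_mem_attr hg hdev.play.2 hpos hattr
      rw [hT] at htT
      obtain ⟨i, hi, hti⟩ := htT
      have h1 : (t : ℕ∞) < (p + Fintype.card V : ℕ) := by
        exact_mod_cast (by omega : t < p + Fintype.card V)
      have h2 := horizonCost_le (N := N) (h1.trans_le hN) hti
      exact absurd (h1.trans_le ((hhigh i hi).trans (h i))) h2.not_gt
  · have hdev' : G.IsDeviation v₀ ρ j (S j) k π := ⟨hdev.play, hag, hown, hne,
      fun t ht ho => by rw [hdev.follows t ht ho, hresp, if_neg fun h => hmem h.2]⟩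
    by_cases hj : G.horizonCost ⊤ j ρ ≤ p ∨ G.horizonCost ⊤ j ρ = ⊤
    · have hnattr : π p ∉ G.attr j W T (Fintype.card V - 1) := fun h => hmem (hA ▸ ⟨h, hj⟩)
      rw [hW] at hnattr
      obtain ⟨π', hdev'', hag', hav⟩ :=
        exists_avoiding_of_notMem_attr hS hdet hdev' hkp T hnattr
      rintro (h | ⟨heq, hle, i₀, hi₀⟩)
      · refine hdet j k π hdev' (Or.inl ?_)
        refine (horizonCost_anti le_top j π).trans_lt (lt_of_lt_of_le h ?_)
        rcases hj with hj | hj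
        · exact (hlow j hj).le
        · exact le_top.trans_eq hj.symm
      · have hnever : ∀ i, ¬ G.horizonCost ⊤ i ρ ≤ p → G.horizonCost ⊤ i π' = ⊤ := by
          intro i hi
          refine top_le_iff.1 (le_horizonCost_iff.2 fun l _ hl => ?_)
          rcases lt_or_ge l p with hlp | hlp
          · rw [hag' l hlp.le] at hl
            have h1 : (l : ℕ∞) < p := by exact_mod_cast hlp
            have h2 := (hhigh i hi).trans ((hle i).trans (horizonCost_le (h1.trans hpN) hl))
            have h3 : p + Fintype.card V ≤ l := by exact_mod_cast h2
            omega
          · exact absurd (hT ▸ ⟨i, hi, hl⟩) (hav l hlp)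
        have hback : ∀ i, G.horizonCost ⊤ i π' ≤ p →
            G.horizonCost N i π = G.horizonCost ⊤ i π' := fun i hi =>
          horizonCost_eq_of_agree (fun u hu => (hag' u hu).symm) (ENat.natCast_lt_top p) hpN hi
        have hle' : ∀ i, G.horizonCost ⊤ i ρ ≤ G.horizonCost ⊤ i π' := by
          intro i
          by_cases hi : G.horizonCost ⊤ i ρ ≤ p
          · by_contra! hlt
            have h1 := hle i
            simp only [hlow i hi, hback i (hlt.le.trans hi)] at h1
            exact absurd hlt h1.not_gt
          · exact le_top.trans_eq (hnever i hi).symm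
        refine hdet j k π' hdev'' (Or.inr ⟨?_, hle', i₀, ?_⟩)
        · rcases hj with hj | hj
          · simp only [hlow j hj] at heq
            have := horizonCost_eq_of_agree (N := ⊤) (M := N) hag' hpN (ENat.natCast_lt_top p)
              (heq ▸ hj)
            exact heq.trans this.symm
          · exact hj.trans (top_le_iff.1 (hj.symm.le.trans (hle' j))).symm
        · by_cases hi : G.horizonCost ⊤ i₀ ρ ≤ p
          · simp only [hlow i₀ hi] at hi₀
            by_contra! hge
            rw [hback i₀ (hge.trans hi)] at hi₀
            exact absurd hi₀ hge.not_gt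
          · have h1 : G.horizonCost ⊤ i₀ (cut p q ρ) < ⊤ :=
              (horizonCost_anti le_top i₀ _).trans_lt (lt_of_lt_of_le hi₀ le_top)
            simp only [hnever i₀ hi]
            rw [horizonCost_cut_add hpq hloop (le_trans
              (by exact_mod_cast Nat.le_add_right q _) ((hgap i₀).resolve_left hi))]
            exact WithTop.add_lt_top.2 ⟨h1, ENat.natCast_lt_top _⟩
    · obtain ⟨rfl, hlt⟩ := hinf.resolve_right fun h => hj (h j)
      push Not at hj
      have hadd := horizonCost_cut_add hpq hloop (le_trans
        (by exact_mod_cast Nat.le_add_right q _) ((hgap j).resolve_left hj.1.not_ge))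
      have hfin : G.horizonCost ⊤ j (cut p q ρ) ≠ ⊤ := fun h => hj.2 (by rw [hadd, h, top_add])
      have hltρ : G.horizonCost ⊤ j (cut p q ρ) < G.horizonCost ⊤ j ρ := by
        rw [hadd]
        exact lt_add_natCast hfin (by omega)
      have hltπ : G.horizonCost ⊤ j (cut p q ρ) < G.horizonCost ⊤ j π :=
        hltρ.trans_le (not_lt.1 fun h => hdet j k π hdev' (Or.inl h))
      rintro (h | ⟨h, -, -⟩)
      · exact absurd h hltπ.not_gt
      · exact hltπ.ne h

lemma exists_deters_cut [Fintype V] {ρ : ℕ → V} {S : ι → (ℕ → V) → ℕ → V}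
    (hρ : G.IsPlay v₀ ρ) (hS : ∀ j, G.IsResponse (S j)) (hdet : G.Deters v₀ ⊤ ρ S) {p q : ℕ}
    (hpq : p ≤ q) (hloop : ρ p = ρ q)
    (hgap : ∀ i, G.horizonCost ⊤ i ρ ≤ p ∨
      (q + Fintype.card V : ℕ) ≤ G.horizonCost ⊤ i ρ) :
    ∃ S' : ι → (ℕ → V) → ℕ → V, (∀ j, G.IsResponse (S' j)) ∧
      ∀ N : ℕ∞, (p + Fintype.card V : ℕ) ≤ N →
        ((N = ⊤ ∧ p < q) ∨ ∀ i, G.horizonCost ⊤ i ρ ≤ p ∨ G.horizonCost ⊤ i ρ = ⊤) →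
        G.Deters v₀ N (cut p q ρ) S' := by
  let T : Set V := {v | ∃ i, ¬ G.horizonCost ⊤ i ρ ≤ p ∧ v ∈ G.F i}
  let W : ι → Set V := fun j => G.safe j {v | v ∈ G.F j ∧ G.horizonCost ⊤ j ρ = ⊤}
  choose g hgE hg using fun j => exists_attr_strategy (G := G) (j := j) (W := W j) T
    fun v hv => (safe_subset j _ hv).2
  have hcard : 1 ≤ Fintype.card V := Fintype.card_pos_iff.2 ⟨v₀⟩
  refine ⟨switchResponse p q ρ S g fun j => {v | v ∈ G.attr j (W j) T (Fintype.card V - 1) ∧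
      (G.horizonCost ⊤ j ρ ≤ p ∨ G.horizonCost ⊤ j ρ = ⊤)},
    isResponse_switchResponse hpq hloop hS hgE, fun N hN hinf j k π hdev => ?_⟩
  rcases lt_or_ge k p with hk | hk
  · exact not_prec_of_early_deviation hS hdet hpq hloop hgap hN hinf rfl rfl (hg j) rfl hk hdev
  · refine not_prec_of_late_deviation hρ hdet hpq hloop (fun i => (hgap i).imp_right
      (le_trans (by exact_mod_cast Nat.add_le_add_left hcard q)))
      (lt_of_lt_of_le (by exact_mod_cast Nat.lt_add_of_pos_right hcard) hN)
      (hinf.imp_left And.left) hk hdev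

/-! ### Histories as prefixes of plays -/

/-- The history, in reversed order, formed by the vertices `π 0, …, π t`. -/
def prefixHist (π : ℕ → V) : ℕ → List V
  | 0 => [π 0]
  | t + 1 => π (t + 1) :: prefixHist π t

lemma length_prefixHist (π : ℕ → V) (t : ℕ) : (prefixHist π t).length = t + 1 := by
  induction t with
  | zero => rfl
  | succ t ih => simp [prefixHist, ih]

lemma cur_prefixHist (π : ℕ → V) (t : ℕ) : cur v₀ (prefixHist π t) = π t := by
  cases t <;> rfl

lemma getD_reverse_prefixHist (π : ℕ → V) {t u : ℕ} (hu : u ≤ t) :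
    (prefixHist π t).reverse.getD u v₀ = π u := by
  induction t with
  | zero =>
    obtain rfl : u = 0 := by omega
    rfl
  | succ t ih =>
    rw [prefixHist, List.reverse_cons]
    rcases Nat.lt_or_ge t u with h | h
    · obtain rfl : u = t + 1 := by omega
      simp [length_prefixHist]
    · rw [List.getD_append _ _ _ _ (by simp [length_prefixHist]; omega), ih h]

lemma prefixHist_congr {π π' : ℕ → V} {t : ℕ} (h : ∀ u ≤ t, π u = π' u) :
    prefixHist π t = prefixHist π' t := by
  induction t with
  | zero => simp [prefixHist, h 0 le_rfl]
  | succ t ih => rw [prefixHist, prefixHist, h _ le_rfl, ih fun u hu => h u (by omega)]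

lemma isHist_prefixHist {π : ℕ → V} (h0 : π 0 = v₀) {t : ℕ}
    (h : ∀ u < t, G.E (π u) (π (u + 1))) : G.IsHist v₀ (prefixHist π t) := by
  induction t with
  | zero => exact h0
  | succ t ih =>
    have ih := ih fun u hu => h u (by omega)
    have ht := h t (by omega)
    cases t <;> exact ⟨ht, ih⟩

lemma histFrom_outcome (σ : ι → List V → V) (t : ℕ) :
    G.histFrom v₀ σ [v₀] t = prefixHist (G.outcome v₀ σ) t := by
  have hex : ∀ t, ∃ π : ℕ → V, G.histFrom v₀ σ [v₀] t = prefixHist π t := by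
    intro t
    induction t with
    | zero => exact ⟨fun _ => v₀, rfl⟩
    | succ t ih =>
      obtain ⟨π, hπ⟩ := ih
      have hag : ∀ x, ∀ u ≤ t, Function.update π (t + 1) x u = π u := fun x u hu =>
        Function.update_of_ne (by omega) _ _
      refine ⟨Function.update π (t + 1) (σ (G.owner (cur v₀ (G.histFrom v₀ σ [v₀] t)))
        (G.histFrom v₀ σ [v₀] t)), ?_⟩
      rw [prefixHist, Function.update_self, histFrom]
      conv_lhs => rw [hπ]
      rw [prefixHist_congr (hag _), hπ]
  induction t with
  | zero => rfl
  | succ t ih =>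
    obtain ⟨π, hπ⟩ := hex (t + 1)
    have hπ' : G.outcome v₀ σ (t + 1) = π (t + 1) := by
      rw [outcome, fullPlay, hπ, getD_reverse_prefixHist _ le_rfl]
    rw [prefixHist, ← ih, hπ', hπ, prefixHist]
    rw [histFrom, prefixHist] at hπ
    rw [(List.cons.inj hπ).2]

lemma outcome_zero (σ : ι → List V → V) : G.outcome v₀ σ 0 = v₀ := rfl

lemma outcome_succ (σ : ι → List V → V) (t : ℕ) :
    G.outcome v₀ σ (t + 1) =
      σ (G.owner (G.outcome v₀ σ t)) (prefixHist (G.outcome v₀ σ) t) := by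
  have h := histFrom_outcome (G := G) (v₀ := v₀) σ (t + 1)
  rw [histFrom, prefixHist, histFrom_outcome, cur_prefixHist] at h
  exact (List.cons.inj h).1.symm

/-- A play consistent with a profile is its outcome. -/
lemma eq_outcome {σ : ι → List V → V} {π : ℕ → V} (h0 : π 0 = v₀)
    (h : ∀ t, π (t + 1) = σ (G.owner (π t)) (prefixHist π t)) : π = G.outcome v₀ σ := by
  have key : ∀ t, ∀ u ≤ t, π u = G.outcome v₀ σ u := by
    intro t
    induction t with
    | zero =>
      intro u hu
      obtain rfl : u = 0 := by omega
      rw [h0, outcome_zero]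
    | succ t ih =>
      intro u hu
      rcases Nat.le_succ_iff.1 hu with hu | rfl
      · exact ih u hu
      · rw [outcome_succ, Nat.succ_eq_add_one, h, ih t le_rfl, prefixHist_congr ih]
  funext t
  exact key t t le_rfl

lemma outcome_edge {d : ℕ} {σ : ι → List V → V} (h : ∀ i, G.IsStratTrunc v₀ d i (σ i)) :
    ∀ t < d, G.E (G.outcome v₀ σ t) (G.outcome v₀ σ (t + 1)) := by
  intro t
  induction t using Nat.strong_induction_on with
  | _ t ih =>
    intro ht
    have := h _ (prefixHist (G.outcome v₀ σ) t)
      (isHist_prefixHist (outcome_zero σ) fun u hu => ih u hu (hu.trans ht))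
      (by rwa [length_prefixHist]) rfl
    rw [cur_prefixHist] at this
    rwa [outcome_succ]

lemma isPlay_outcome {σ : ι → List V → V} (h : G.IsProfile v₀ σ) :
    G.IsPlay v₀ (G.outcome v₀ σ) :=
  ⟨outcome_zero σ, fun t => outcome_edge (d := t + 1) (fun i l hl _ => h i l hl) t t.lt_succ_self⟩

/-- A secure equilibrium yields responses that deter all deviations from its outcome. -/
lemma IsSecure.exists_deters [DecidableEq ι] {σ : ι → List V → V} (hσ : G.IsProfile v₀ σ)
    (hsec : G.IsSecure v₀ σ) :
    ∃ S : ι → (ℕ → V) → ℕ → V, (∀ j, G.IsResponse (S j)) ∧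
      G.Deters v₀ ⊤ (G.outcome v₀ σ) S := by
  choose c hc using G.total
  refine ⟨fun _ π t => if G.E (π t) (σ (G.owner (π t)) (prefixHist π t)) then
    σ (G.owner (π t)) (prefixHist π t) else c (π t), fun _ => ⟨fun h => ?_, fun π t => ?_⟩, ?_⟩
  · simp only [h _ le_rfl, prefixHist_congr h]
  · dsimp only
    split_ifs with h
    · exact h
    · exact hc _
  · intro j k π hdev hprec
    let σ' : List V → V := fun h =>
      if prefixHist π (h.length - 1) = h then π h.length else c (cur v₀ h)
    have hσ' : G.IsStrat v₀ j σ' := by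
      intro h hh _
      simp only [σ']
      split_ifs with heq
      · have hlen : h.length ≠ 0 := fun h0 => by
          rw [List.length_eq_zero_iff.1 h0] at hh
          exact hh
        have := hdev.play.2 (h.length - 1)
        rw [← cur_prefixHist (v₀ := v₀) π, heq] at this
        rwa [Nat.sub_add_cancel (by omega)] at this
      · exact hc _
    have hπ : π = G.outcome v₀ (Function.update σ j σ') := by
      refine eq_outcome hdev.play.1 fun t => ?_
      by_cases ho : G.owner (π t) = j
      · rw [ho, Function.update_self]
        simp [σ', length_prefixHist]
      · rw [Function.update_of_ne ho]
        rcases Nat.lt_or_ge k t with hkt | hkt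
        · refine (hdev.follows t hkt ho).trans (if_pos ?_)
          have := hσ _ (prefixHist π t) (isHist_prefixHist hdev.play.1 fun u _ => hdev.play.2 u) rfl
          rwa [cur_prefixHist] at this
        · have hne : t ≠ k := by
            rintro rfl
            exact ho (by rw [hdev.agree t le_rfl, hdev.owner])
          rw [hdev.agree _ (by omega), outcome_succ, hdev.agree t hkt,
            prefixHist_congr fun u hu => hdev.agree u (by omega)]
    refine hsec ⟨j, σ', hσ', ?_⟩
    simp only [horizonCost_top] at hprec
    rw [hπ] at hprec
    exact hprec

/-! ### Plays with minimal total cost -/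

lemma exists_loop [Fintype V] (ρ : ℕ → V) (a : ℕ) :
    ∃ p q, a ≤ p ∧ p < q ∧ q ≤ a + Fintype.card V ∧ ρ p = ρ q := by
  obtain ⟨x, y, hxy, heq⟩ := Fintype.exists_ne_map_eq_of_card_lt
    (fun n : Fin (Fintype.card V + 1) => ρ (a + n)) (by simp)
  wlog hlt : x < y generalizing x y
  · exact this y x hxy.symm heq.symm (lt_of_le_of_ne (not_lt.1 hlt) hxy.symm)
  · exact ⟨a + x, a + y, by omega, by have : (x : ℕ) < y := hlt; omega, by omega, heq⟩

/-- If some value of `c` is finite but large, then there is a window of length `L` whose interior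
contains no value of `c`, and which lies below that value. -/
lemma exists_gap [Fintype ι] (c : ι → ℕ∞) (L : ℕ) {i₀ : ι}
    (h : ((L * Fintype.card ι : ℕ) : ℕ∞) ≤ c i₀) :
    ∃ a : ℕ, a + L ≤ L * Fintype.card ι ∧ ∀ i, c i ≤ a ∨ ((a + L : ℕ) : ℕ∞) ≤ c i := by
  by_contra! hcon
  have key : ∀ m : Fin (Fintype.card ι), ∃ i, ((L * m : ℕ) : ℕ∞) < c i ∧
      c i < ((L * m + L : ℕ) : ℕ∞) := fun m => hcon (L * m) (by
    calc L * (m : ℕ) + L = L * (m + 1) := by ring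
      _ ≤ _ := Nat.mul_le_mul_left _ m.2)
  choose f hf1 hf2 using key
  have hle : ∀ m n : Fin (Fintype.card ι), f m = f n → n ≤ m := by
    intro m n heq
    have h1 := (hf1 n).trans (heq ▸ hf2 m)
    have h2 : L * (n : ℕ) < L * (m + 1) := by exact_mod_cast h1
    exact Nat.lt_succ_iff.1 (lt_of_mul_lt_mul_left h2 (Nat.zero_le L))
  have hinj : Function.Injective f := fun m n heq => le_antisymm (hle n m heq.symm) (hle m n heq)
  obtain ⟨m, rfl⟩ := ((Fintype.bijective_iff_injective_and_card f).2 ⟨hinj, by simp⟩).2 i₀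
  have h1 := h.trans_lt (hf2 m)
  have h2 : L * Fintype.card ι < L * (m + 1) := by exact_mod_cast h1
  have h3 := lt_of_mul_lt_mul_left h2 (Nat.zero_le L)
  have := m.2
  omega

lemma toNat_horizonCost_cut_le {ρ : ℕ → V} {p q a : ℕ} (hap : a ≤ p) (hpq : p < q)
    (hloop : ρ p = ρ q) {i : ι}
    (h : G.horizonCost ⊤ i ρ ≤ a ∨ (q : ℕ∞) ≤ G.horizonCost ⊤ i ρ) :
    (G.horizonCost ⊤ i (cut p q ρ)).toNat ≤ (G.horizonCost ⊤ i ρ).toNat := by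
  rcases h with h | h
  · rw [horizonCost_cut_of_le q (ENat.natCast_lt_top _) (h.trans (by exact_mod_cast hap))]
  · rw [horizonCost_cut_add hpq.le hloop h]
    by_cases htop : G.horizonCost ⊤ i (cut p q ρ) = ⊤
    · simp [htop]
    · rw [ENat.toNat_add htop (ENat.natCast_ne_top _)]
      omega

/-- Some deterring pair has all finite costs bounded by `2 * |ι| * |V|`. -/
lemma exists_deters_cost_lt [Fintype ι] [Fintype V] {ρ : ℕ → V} {S : ι → (ℕ → V) → ℕ → V}
    (hρ : G.IsPlay v₀ ρ) (hS : ∀ j, G.IsResponse (S j)) (hdet : G.Deters v₀ ⊤ ρ S) :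
    ∃ (ρ : ℕ → V) (S : ι → (ℕ → V) → ℕ → V), G.IsPlay v₀ ρ ∧ (∀ j, G.IsResponse (S j)) ∧
      G.Deters v₀ ⊤ ρ S ∧ ∀ i, G.horizonCost ⊤ i ρ ≠ ⊤ →
        G.horizonCost ⊤ i ρ < (2 * Fintype.card ι * Fintype.card V : ℕ) := by
  obtain ⟨n, hn⟩ : ∃ n, ∑ i, (G.horizonCost ⊤ i ρ).toNat = n := ⟨_, rfl⟩
  induction n using Nat.strong_induction_on generalizing ρ S with
  | _ n ih =>
    by_cases hsmall : ∀ i, G.horizonCost ⊤ i ρ ≠ ⊤ →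
        G.horizonCost ⊤ i ρ < (2 * Fintype.card ι * Fintype.card V : ℕ)
    · exact ⟨ρ, S, hρ, hS, hdet, hsmall⟩
    · push Not at hsmall
      obtain ⟨i₀, hfin, hi₀⟩ := hsmall
      have hmul : 2 * Fintype.card ι * Fintype.card V =
          2 * Fintype.card V * Fintype.card ι := by ring
      rw [hmul] at hi₀
      obtain ⟨a, ha, hgap⟩ := exists_gap (fun i => G.horizonCost ⊤ i ρ) _ hi₀
      obtain ⟨p, q, hap, hpq, hqa, hloop⟩ := exists_loop ρ a
      have hlate : ∀ i, G.horizonCost ⊤ i ρ ≤ a ∨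
          (q + Fintype.card V : ℕ) ≤ G.horizonCost ⊤ i ρ := fun i =>
        (hgap i).imp_right (le_trans (by exact_mod_cast (by omega)))
      have hq : ∀ i, (q + Fintype.card V : ℕ) ≤ G.horizonCost ⊤ i ρ →
          (q : ℕ∞) ≤ G.horizonCost ⊤ i ρ := fun i =>
        le_trans (by exact_mod_cast Nat.le_add_right q _)
      obtain ⟨S', hS', hdet'⟩ := exists_deters_cut hρ hS hdet hpq.le hloop fun i =>
        (hlate i).imp_left fun h => h.trans (by exact_mod_cast hap)
      refine ih _ ?_ (hρ.cut hpq.le hloop) hS' (hdet' ⊤ le_top (Or.inl ⟨rfl, hpq⟩)) rfl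
      rw [← hn]
      refine Finset.sum_lt_sum (fun i _ =>
        toNat_horizonCost_cut_le hap hpq hloop ((hlate i).imp_right (hq i)))
        ⟨i₀, Finset.mem_univ _, ?_⟩
      have hadd := horizonCost_cut_add hpq.le hloop (i := i₀) (G := G)
        (le_trans (by exact_mod_cast (by omega)) hi₀)
      have hfin' : G.horizonCost ⊤ i₀ (cut p q ρ) ≠ ⊤ := fun h => hfin (by rw [hadd, h, top_add])
      rw [hadd, ENat.toNat_add hfin' (ENat.natCast_ne_top _), ENat.toNat_natCast]
      omega

/-! ### Back to strategies -/

/-- The strategy that applies the response rule `R` to the current history. -/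
def responseStrategy (v₀ : V) (R : (ℕ → V) → ℕ → V) (h : List V) : V :=
  R (fun n => h.reverse.getD n v₀) (h.length - 1)

lemma responseStrategy_prefixHist {R : (ℕ → V) → ℕ → V} (hR : G.IsResponse R) (π : ℕ → V)
    (t : ℕ) : responseStrategy v₀ R (prefixHist π t) = R π t := by
  rw [responseStrategy, length_prefixHist, Nat.add_sub_cancel]
  exact hR.congr fun u hu => getD_reverse_prefixHist π hu

lemma IsResponse.edge_responseStrategy {R : (ℕ → V) → ℕ → V} (hR : G.IsResponse R) {h : List V}
    (hh : G.IsHist v₀ h) : G.E (cur v₀ h) (responseStrategy v₀ R h) := by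
  have hcur : cur v₀ h = h.reverse.getD (h.length - 1) v₀ := by
    cases h with
    | nil => exact hh.elim
    | cons v l => simp [cur]
  rw [hcur]
  exact hR.edge (fun n => h.reverse.getD n v₀) _

/-- Follow `ρ`; as soon as the owner `j` of some `ρ k` leaves `ρ`, apply `S j`. -/
noncomputable def punish (G : QRGame ι V) (ρ : ℕ → V) (S : ι → (ℕ → V) → ℕ → V) (c : V → V)
    (π : ℕ → V) (t : ℕ) : V :=
  if h : ∃ k < t, (∀ u ≤ k, π u = ρ u) ∧ π (k + 1) ≠ ρ (k + 1) then
    S (G.owner (ρ h.choose)) π t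
  else if π t = ρ t then ρ (t + 1) else c (π t)

section punish

variable {ρ : ℕ → V} {S : ι → (ℕ → V) → ℕ → V} {c : V → V}

lemma punish_of_agree {π : ℕ → V} {t : ℕ} (h : ∀ u ≤ t, π u = ρ u) :
    G.punish ρ S c π t = ρ (t + 1) := by
  rw [punish, dif_neg, if_pos (h t le_rfl)]
  rintro ⟨k, hk, -, hne⟩
  exact hne (h _ hk)

lemma punish_of_leaves {π : ℕ → V} {k t : ℕ} (hkt : k < t) (h : ∀ u ≤ k, π u = ρ u)
    (hne : π (k + 1) ≠ ρ (k + 1)) : G.punish ρ S c π t = S (G.owner (ρ k)) π t := by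
  have hex : ∃ k < t, (∀ u ≤ k, π u = ρ u) ∧ π (k + 1) ≠ ρ (k + 1) := ⟨k, hkt, h, hne⟩
  have hk : hex.choose = k := by
    obtain ⟨-, h1, h2⟩ := hex.choose_spec
    rcases lt_trichotomy hex.choose k with hlt | heq | hlt
    · exact absurd (h _ hlt) h2
    · exact heq
    · exact absurd (h1 _ hlt) hne
  rw [punish, dif_pos hex, hk]

lemma isResponse_punish (hρ : G.IsPlay v₀ ρ) (hS : ∀ j, G.IsResponse (S j))
    (hc : ∀ v, G.E v (c v)) : G.IsResponse (G.punish ρ S c) where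
  congr {π π' t} h := by
    by_cases hex : ∃ k < t, (∀ u ≤ k, π u = ρ u) ∧ π (k + 1) ≠ ρ (k + 1)
    · obtain ⟨k, hk, hag, hne⟩ := hex
      rw [punish_of_leaves hk hag hne, punish_of_leaves (π := π') hk
        (fun u hu => by rw [← h u (by omega), hag u hu]) (by rwa [← h _ hk]), (hS _).congr h]
    · have hex' : ¬ ∃ k < t, (∀ u ≤ k, π' u = ρ u) ∧ π' (k + 1) ≠ ρ (k + 1) := by
        rintro ⟨k, hk, hag, hne⟩
        exact hex ⟨k, hk, fun u hu => by rw [h u (by omega), hag u hu], by rwa [h _ hk]⟩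
      rw [punish, punish, dif_neg hex, dif_neg hex', h t le_rfl]
  edge π t := by
    unfold punish
    split_ifs with h1 h2
    · exact (hS _).edge _ _
    · rw [h2]
      exact hρ.2 t
    · exact hc _

lemma outcome_punish (hρ : G.IsPlay v₀ ρ) (hS : ∀ j, G.IsResponse (S j))
    (hc : ∀ v, G.E v (c v)) :
    G.outcome v₀ (fun _ => responseStrategy v₀ (G.punish ρ S c)) = ρ :=
  (eq_outcome hρ.1 fun t => by
    rw [responseStrategy_prefixHist (isResponse_punish hρ hS hc),
      punish_of_agree fun _ _ => rfl]).symm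

/-- Responses deterring deviations up to some horizon make deviations from the punishing profile
of the truncated game unprofitable. -/
lemma Deters.not_prec [DecidableEq ι] {N : ℕ∞} {d : ℕ} (hdet : G.Deters v₀ N ρ S)
    (hN : N ≤ (d + 1 : ℕ)) (hρ : G.IsPlay v₀ ρ) (hS : ∀ j, G.IsResponse (S j))
    (hc : ∀ v, G.E v (c v)) {j : ι} {σ' : List V → V} (hσ' : G.IsStratTrunc v₀ d j σ') :
    ¬ Prec j (fun i => G.horizonCost N i ρ) (fun i => G.horizonCost N i
      (G.outcome v₀ (Function.update (fun _ => responseStrategy v₀ (G.punish ρ S c)) j σ'))) := by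
  have hR := isResponse_punish hρ hS hc
  set σ := Function.update (fun _ => responseStrategy v₀ (G.punish ρ S c)) j σ' with hσ
  set π := G.outcome v₀ σ with hπ
  have hE : ∀ t < d, G.E (π t) (π (t + 1)) := outcome_edge fun i => by
    by_cases hi : i = j
    · subst hi
      rwa [hσ, Function.update_self]
    · rw [hσ, Function.update_of_ne hi]
      exact fun h hh _ _ => hR.edge_responseStrategy hh
  have hnext : ∀ t, G.owner (π t) ≠ j → π (t + 1) = G.punish ρ S c π t := fun t ho => by
    rw [hπ, outcome_succ, ← hπ, hσ, Function.update_of_ne ho, responseStrategy_prefixHist hR]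
  have hlt : ∀ l : ℕ, (l : ℕ∞) < N → l ≤ d := fun l hl => by
    have h1 := hl.trans_le hN
    have h2 : l < d + 1 := by exact_mod_cast h1
    omega
  by_cases hag : ∀ u ≤ d, π u = ρ u
  · rw [funext fun i => horizonCost_congr i fun l hl => hag l (hlt l hl)]
    exact not_prec_self j _
  · push Not at hag
    obtain ⟨n, hn, hmin⟩ := (⟨_, Nat.find_spec hag, fun u => Nat.find_min hag⟩ :
      ∃ n, (n ≤ d ∧ π n ≠ ρ n) ∧ ∀ u < n, ¬ (u ≤ d ∧ π u ≠ ρ u))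
    obtain ⟨k, rfl⟩ : ∃ k, n = k + 1 := Nat.exists_eq_succ_of_ne_zero <| by
      rintro rfl
      exact hn.2 hρ.1.symm
    have hagk : ∀ u ≤ k, π u = ρ u := fun u hu => by
      by_contra h
      exact hmin u (by omega) ⟨by omega, h⟩
    have hown : G.owner (ρ k) = j := by
      by_contra ho
      rw [← hagk k le_rfl] at ho
      exact hn.2 (by rw [hnext k ho, punish_of_agree hagk])
    obtain ⟨π', hdev, hag', -⟩ := IsDeviation.exists_continuation (hS j) hc (outcome_zero σ) hE hagk
      hown hn.2 hn.1 fun t hkt _ ho => by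
        refine (hnext t ho).trans ?_
        rw [punish_of_leaves hkt hagk hn.2, hown]
    have := hdet j k π' hdev
    rwa [funext fun i => horizonCost_congr i fun l hl => hag' l (hlt l hl)] at this

end punish

end QRGame

open QRGame

/-- Let `Γ = 2·|Π|·|V|` and `d = Γ + 3·|V|`.  If there exists a secure
equilibrium in `(G, v₀)`, then there exists a goal-optimal and dev-optimal
secure equilibrium in the truncated game `𝒯^d`. -/
theorem truncated_secure_equilibrium_from_secure
    {ι V : Type} [Fintype ι] [Fintype V] [DecidableEq ι]
    (G : QRGame ι V) (v₀ : V) (Γ d : ℕ)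
    (hΓ : Γ = 2 * Fintype.card ι * Fintype.card V)
    (hd : d = Γ + 3 * Fintype.card V)
    (hex : ∃ σ : ι → List V → V, G.IsProfile v₀ σ ∧ G.IsSecure v₀ σ) :
    ∃ τ : ι → List V → V, (∀ i, G.IsStratTrunc v₀ d i (τ i)) ∧
      G.IsSecureTrunc v₀ d τ ∧ G.GoalOptTrunc v₀ d τ Γ ∧ G.DevOptTrunc v₀ d τ := by
  obtain ⟨σ, hσ, hsec⟩ := hex
  obtain ⟨S₀, hS₀, hdet₀⟩ := IsSecure.exists_deters hσ hsec
  obtain ⟨ρ, S₁, hρ, hS₁, hdet₁, hlt⟩ := exists_deters_cost_lt (isPlay_outcome hσ) hS₀ hdet₀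
  rw [← hΓ] at hlt
  have hΓd : (Γ : ℕ∞) ≤ (d + 1 : ℕ) := by exact_mod_cast (by omega)
  have hcost : ∀ i, G.costLT i ρ (d + 1) = G.horizonCost ⊤ i ρ := fun i => by
    rw [← horizonCost_coe]
    by_cases htop : G.horizonCost ⊤ i ρ = ⊤
    · exact le_antisymm (le_top.trans_eq htop.symm) (horizonCost_anti le_top i ρ)
    · exact horizonCost_eq_of_lt le_top ((hlt i htop).trans_le hΓd)
  obtain ⟨m, hm⟩ : ∃ m : ℕ, (m : ℕ∞) =
      ⨆ i ∈ {i : ι | G.horizonCost ⊤ i ρ ≠ ⊤}, G.horizonCost ⊤ i ρ :=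
    ENat.ne_top_iff_exists.1 (ne_top_of_le_ne_top (ENat.natCast_ne_top Γ)
      (iSup₂_le fun i hi => (hlt i hi).le))
  have hmΓ : m ≤ Γ := by
    have : (m : ℕ∞) ≤ Γ := hm.trans_le (iSup₂_le fun i hi => (hlt i hi).le)
    exact_mod_cast this
  have hcm : ∀ i, G.horizonCost ⊤ i ρ ≤ m ∨ G.horizonCost ⊤ i ρ = ⊤ := fun i => by
    by_cases htop : G.horizonCost ⊤ i ρ = ⊤
    · exact Or.inr htop
    · exact Or.inl (hm ▸ le_iSup₂_of_le i htop le_rfl)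
  obtain ⟨S, hS, hdet⟩ := exists_deters_cut hρ hS₁ hdet₁ (le_refl m) rfl
    fun i => (hcm i).imp_right fun h => le_top.trans_eq h.symm
  have hcut : cut m m ρ = ρ := by
    funext t
    rcases le_total t m with h | h
    · exact cut_of_le ρ h
    · rw [cut_of_ge le_rfl rfl h, Nat.sub_self, Nat.add_zero]
  rw [hcut] at hdet
  choose c hc using G.total
  have hout := outcome_punish hρ hS hc
  have hD : G.devBoundTrunc v₀ d (fun _ => responseStrategy v₀ (G.punish ρ S c)) =
      m + Fintype.card V := by
    simp only [devBoundTrunc, hout, hcost]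
    rw [← hm, ENat.toNat_natCast]
  refine ⟨fun _ => responseStrategy v₀ (G.punish ρ S c),
    fun i h hh _ _ => (isResponse_punish hρ hS hc).edge_responseStrategy hh, ?_, ?_, ?_⟩
  · rintro ⟨j, σ', hσ', hprec⟩
    refine (hdet (d + 1 : ℕ) (by exact_mod_cast (by omega)) (Or.inr hcm)).not_prec le_rfl hρ hS hc
      hσ' ?_
    simp only [horizonCost_coe]
    conv at hprec => arg 2; rw [← outcome, hout]
    exact hprec
  · intro i hi
    rw [hout, hcost] at hi ⊢
    exact hlt i hi
  · intro j σ' hσ' hprec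
    rw [hD, hout] at hprec
    refine (hdet (m + Fintype.card V : ℕ) le_rfl (Or.inr hcm)).not_prec
      (by exact_mod_cast (by omega)) hρ hS hc hσ' ?_
    simp only [horizonCost_coe]
    exact hprec
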